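/- arXiv:1112.5378 — 4 statements merged into one kernel-verified Lean document; each statement's English description precedes it below -/
import Mathlib

section
/- Let q be a power of a prime p, let L be an algebraically closed field extension of 𝔽_q(T), complete with respect to an additive valuation v satisfying v(T) = −1, and let A, B ∈ L with B ≠ 0 and v(j) < −q, where j := A^{q+1}/B. Let δ ∈ L satisfy B δ^{q²−1} + A δ^{q−1} + T = 0 and v(δ) = (v(A) − v(B))/(q² − q), and let γ ∈ L satisfy γ^{q−1} = T/B. Set c := δ^{−1}γ. Then v(c/δ^q) = −(v(j) + q)/(q² − q) > 0, the series η := −δ ∑_{n=0}^∞ (c/δ^q)^{q^n} converges in L, v(η) = −(1 + v(A))/(q − 1), and B η^{q²−1} + A η^{q−1} + T = 0. -/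
/-- `x` is the limit of the sequence `f` with respect to the additive valuation `v`
(valued in `ℝ ∪ {∞} = ` `EReal`): `v (f n - x) → ∞`. -/
def IsVLimit {L : Type*} [Field L] (v : L → EReal) (f : ℕ → L) (x : L) : Prop :=
  ∀ M : ℝ, ∃ N : ℕ, ∀ n : ℕ, N ≤ n → (M : EReal) < v (f n - x)

/-- `v` is an additive valuation on the field `L` with values in `ℝ ∪ {∞}`. -/
structure IsAddVal {L : Type*} [Field L] (v : L → EReal) : Prop where
  eq_top_iff : ∀ x : L, v x = ⊤ ↔ x = 0
  ne_bot : ∀ x : L, v x ≠ ⊥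
  map_mul : ∀ x y : L, v (x * y) = v x + v y
  min_le_add : ∀ x y : L, min (v x) (v y) ≤ v (x + y)

namespace IsAddVal

variable {L : Type*} [Field L] {v : L → EReal}

theorem map_zero (h : IsAddVal v) : v 0 = ⊤ := (h.eq_top_iff 0).2 rfl

theorem exists_coe (h : IsAddVal v) {x : L} (hx : x ≠ 0) : ∃ r : ℝ, v x = r :=
  ⟨(v x).toReal, (EReal.coe_toReal (fun e => hx ((h.eq_top_iff x).1 e)) (h.ne_bot x)).symm⟩

theorem ne_zero_of_coe (h : IsAddVal v) {x : L} {r : ℝ} (hx : v x = r) : x ≠ 0 := by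
  rintro rfl
  rw [h.map_zero] at hx
  exact EReal.coe_ne_top r hx.symm

theorem map_one (h : IsAddVal v) : v 1 = 0 := by
  obtain ⟨r, hr⟩ := h.exists_coe (one_ne_zero (α := L))
  have h1 := h.map_mul 1 1
  rw [mul_one, hr] at h1
  have h2 : r = r + r := by exact_mod_cast h1
  rw [hr, show r = 0 by linarith, EReal.coe_zero]

theorem map_mul_coe (h : IsAddVal v) {x y : L} {r s : ℝ} (hx : v x = r) (hy : v y = s) :
    v (x * y) = (r + s : ℝ) := by
  rw [h.map_mul, hx, hy, EReal.coe_add]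

theorem map_pow_coe (h : IsAddVal v) {x : L} {r : ℝ} (hx : v x = r) (n : ℕ) :
    v (x ^ n) = (n * r : ℝ) := by
  induction n with
  | zero => simp [h.map_one]
  | succ n ih =>
    rw [pow_succ, h.map_mul_coe ih hx]
    congr 1
    push_cast
    ring

theorem map_inv_coe (h : IsAddVal v) {x : L} {r : ℝ} (hx : v x = r) :
    v x⁻¹ = (-r : ℝ) := by
  have hx0 := h.ne_zero_of_coe hx
  obtain ⟨s, hs⟩ := h.exists_coe (inv_ne_zero hx0)
  have h1 := h.map_mul_coe hx hs
  rw [mul_inv_cancel₀ hx0, h.map_one] at h1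
  have h2 : 0 = r + s := by exact_mod_cast h1
  rw [hs, show s = -r by linarith]

theorem map_div_coe (h : IsAddVal v) {x y : L} {r s : ℝ} (hx : v x = r) (hy : v y = s) :
    v (x / y) = (r - s : ℝ) := by
  rw [div_eq_mul_inv, h.map_mul_coe hx (h.map_inv_coe hy), sub_eq_add_neg]

theorem map_neg (h : IsAddVal v) (x : L) : v (-x) = v x := by
  have h1 : v (-1) = 0 := by
    obtain ⟨r, hr⟩ := h.exists_coe (neg_ne_zero.2 (one_ne_zero (α := L)))
    have h1 := h.map_mul_coe hr hr
    rw [neg_one_mul, neg_neg, h.map_one] at h1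
    have h2 : 0 = r + r := by exact_mod_cast h1
    rw [hr, show r = 0 by linarith, EReal.coe_zero]
  rw [← neg_one_mul, h.map_mul, h1, zero_add]

theorem lt_add (h : IsAddVal v) {x y : L} {M : EReal} (hx : M < v x) (hy : M < v y) :
    M < v (x + y) :=
  (lt_min hx hy).trans_le (h.min_le_add x y)

theorem lt_sub (h : IsAddVal v) {x y : L} {M : EReal} (hx : M < v x) (hy : M < v y) :
    M < v (x - y) := by
  rw [sub_eq_add_neg]
  exact h.lt_add hx (by rwa [h.map_neg])

theorem lt_sum (h : IsAddVal v) {ι : Type*} (s : Finset ι) (f : ι → L) {M : ℝ}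
    (hf : ∀ i ∈ s, (M : EReal) < v (f i)) : (M : EReal) < v (∑ i ∈ s, f i) := by
  refine Finset.sum_induction f (fun x => (M : EReal) < v x) (fun _ _ => h.lt_add) ?_ hf
  rw [h.map_zero]
  exact EReal.coe_lt_top M

theorem map_add_eq_of_lt (h : IsAddVal v) {x y : L} (hxy : v x < v y) : v (x + y) = v x := by
  refine le_antisymm (not_lt.1 fun hlt => ?_) ((le_min le_rfl hxy.le).trans (h.min_le_add x y))
  have := h.lt_sub hlt hxy
  rw [add_sub_cancel_right] at this
  exact lt_irrefl _ this

theorem eq_zero_of_forall_lt (h : IsAddVal v) {x : L} (hx : ∀ M : ℝ, (M : EReal) < v x) :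
    x = 0 :=
  (h.eq_top_iff x).1 (EReal.eq_top_iff_forall_lt _ |>.2 hx)

theorem lt_pow (h : IsAddVal v) {x : L} {M : ℝ} (hM : 0 ≤ M) (hx : (M : EReal) < v x) {n : ℕ}
    (hn : n ≠ 0) : (M : EReal) < v (x ^ n) := by
  rcases eq_or_ne x 0 with rfl | hx0
  · rwa [zero_pow hn]
  obtain ⟨r, hr⟩ := h.exists_coe hx0
  rw [hr, EReal.coe_lt_coe_iff] at hx
  rw [h.map_pow_coe hr, EReal.coe_lt_coe_iff]
  have h1 : (1 : ℝ) ≤ n := by exact_mod_cast Nat.one_le_iff_ne_zero.2 hn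
  nlinarith

theorem lt_mul_of_sub_lt (h : IsAddVal v) {a x : L} {M r : ℝ} (ha : v a = r)
    (hx : ((M - r : ℝ) : EReal) < v x) : (M : EReal) < v (a * x) := by
  rcases eq_or_ne x 0 with rfl | hx0
  · rw [mul_zero, h.map_zero]
    exact EReal.coe_lt_top M
  obtain ⟨s, hs⟩ := h.exists_coe hx0
  rw [hs, EReal.coe_lt_coe_iff] at hx
  rw [h.map_mul_coe ha hs, EReal.coe_lt_coe_iff]
  linarith

/-- The terms `a * u ^ q ^ n` tend to `0` when `v u > 0`. -/
theorem exists_lt_mul_pow (h : IsAddVal v) {a u : L} {r d : ℝ} (ha : v a = d) (hu : v u = r)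
    (hr : 0 < r) {q : ℕ} (hq : 2 ≤ q) (M : ℝ) :
    ∃ N : ℕ, ∀ n, N ≤ n → (M : EReal) < v (a * u ^ q ^ n) := by
  obtain ⟨N, hN⟩ := exists_nat_gt ((M - d) / r)
  refine ⟨N, fun n hn => ?_⟩
  rw [h.map_mul_coe ha (h.map_pow_coe hu _), EReal.coe_lt_coe_iff]
  have h1 : (N : ℝ) ≤ (q ^ n : ℕ) := by
    exact_mod_cast hn.trans (Nat.lt_pow_self hq).le
  rw [div_lt_iff₀ hr] at hN
  nlinarith

theorem cauchy_series (h : IsAddVal v) {a u : L} {r d : ℝ} (ha : v a = d) (hu : v u = r)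
    (hr : 0 < r) {q : ℕ} (hq : 2 ≤ q) (M : ℝ) :
    ∃ N : ℕ, ∀ m : ℕ, N ≤ m → ∀ n : ℕ, N ≤ n →
      (M : EReal) < v (a * ∑ i ∈ Finset.range m, u ^ q ^ i -
        a * ∑ i ∈ Finset.range n, u ^ q ^ i) := by
  obtain ⟨N, hN⟩ := h.exists_lt_mul_pow ha hu hr hq M
  have key : ∀ m n : ℕ, N ≤ m → m ≤ n →
      (M : EReal) < v (a * ∑ i ∈ Finset.range n, u ^ q ^ i -
        a * ∑ i ∈ Finset.range m, u ^ q ^ i) := by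
    intro m n hm hmn
    rw [← mul_sub, ← Finset.sum_Ico_eq_sub _ hmn, Finset.mul_sum]
    exact h.lt_sum _ _ fun i hi => hN i (hm.trans (Finset.mem_Ico.1 hi).1)
  refine ⟨N, fun m hm n hn => ?_⟩
  rcases le_total n m with hnm | hmn
  · exact key n m hn hnm
  · rw [← h.map_neg, neg_sub]
    exact key m n hm hmn

/-- The leading term of `a * ∑ u ^ q ^ n` determines its valuation. -/
theorem map_limit_series (h : IsAddVal v) {a u η : L} {r d : ℝ} (ha : v a = d) (hu : v u = r)
    (hr : 0 < r) {q : ℕ} (hq : 2 ≤ q)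
    (hη : IsVLimit v (fun N => a * ∑ n ∈ Finset.range N, u ^ q ^ n) η) :
    v η = (d + r : ℝ) := by
  obtain ⟨N, hN⟩ := hη (d + r)
  have h1 := hN (N + 1) N.le_succ
  have h2 : ((d + r : ℝ) : EReal) < v (a * ∑ n ∈ Finset.range N, u ^ q ^ (n + 1)) := by
    rw [Finset.mul_sum]
    refine h.lt_sum _ _ fun i _ => ?_
    rw [h.map_mul_coe ha (h.map_pow_coe hu _), EReal.coe_lt_coe_iff]
    have : (2 : ℝ) ≤ (q ^ (i + 1) : ℕ) := by
      exact_mod_cast hq.trans (Nat.le_self_pow i.succ_ne_zero q)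
    nlinarith
  have h3 := h.map_mul_coe ha hu
  have h4 := h.lt_sub h2 h1
  rw [← h3] at h4
  rw [← h3, ← h.map_add_eq_of_lt h4]
  congr 1
  simp only [Finset.sum_range_succ', pow_zero, pow_one]
  ring

/-- The limit of the series `-δ ∑ u ^ q ^ n` solves an Artin–Schreier type equation. -/
theorem limit_series_pow (h : IsAddVal v) {p s q : ℕ} (hp : p.Prime) [CharP L p]
    (hq : q = p ^ s) (hq2 : 2 ≤ q) {δ u η : L} {r d : ℝ} (hδ : v δ = d) (hu : v u = r)
    (hr : 0 < r) (hη : IsVLimit v (fun N => -δ * ∑ n ∈ Finset.range N, u ^ q ^ n) η) :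
    η ^ q = δ ^ (q - 1) * η + δ ^ q * u := by
  have : Fact p.Prime := ⟨hp⟩
  have hsub : ∀ x y : L, (x - y) ^ q = x ^ q - y ^ q := fun x y => by
    rw [hq]; exact sub_pow_char_pow x y s
  have hneg : ∀ x : L, (-x) ^ q = -x ^ q := fun x => by
    have := hsub 0 x
    rwa [zero_sub, zero_pow (by lia), zero_sub] at this
  have hsum : ∀ N, (∑ n ∈ Finset.range N, u ^ q ^ n) ^ q =
      ∑ n ∈ Finset.range N, u ^ q ^ n - u + u ^ q ^ N := by
    intro N
    have h1 : (∑ n ∈ Finset.range N, u ^ q ^ n) ^ q =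
        ∑ n ∈ Finset.range N, u ^ q ^ (n + 1) := by
      rw [hq, sum_pow_char_pow, ← hq]
      exact Finset.sum_congr rfl fun n _ => by rw [← pow_mul, ← pow_succ]
    have h2 := Finset.sum_range_succ' (fun n => u ^ q ^ n) N
    rw [Finset.sum_range_succ, pow_zero, pow_one] at h2
    rw [h1]
    linear_combination -h2
  have hδq : δ ^ q = δ ^ (q - 1) * δ := by
    rw [← pow_succ]; congr 1; lia
  refine sub_eq_zero.1 (h.eq_zero_of_forall_lt fun M => ?_)
  obtain ⟨N₁, h₁⟩ := hη (max M 0)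
  obtain ⟨N₂, h₂⟩ := hη (M - ((q - 1 : ℕ) * d))
  obtain ⟨N₃, h₃⟩ := h.exists_lt_mul_pow (h.map_pow_coe hδ q) hu hr hq2 M
  set N := max N₁ (max N₂ N₃)
  have e₁ := h.lt_pow (le_max_right M 0) (h₁ N (by simp [N])) (by lia : q ≠ 0)
  have e₁' := (EReal.coe_le_coe_iff.2 (le_max_left M 0)).trans_lt e₁
  have e₂ := h.lt_mul_of_sub_lt (h.map_pow_coe hδ (q - 1)) (h₂ N (by simp [N]))
  have e₃ := h₃ N (by simp [N])
  have e₄ := h.lt_sub (h.lt_sub e₂ e₁') e₃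
  refine e₄.trans_eq (congrArg v ?_)
  rw [hsub, mul_pow, hneg, hsum]
  linear_combination (∑ n ∈ Finset.range N, u ^ q ^ n) * hδq

end IsAddVal

/-- Factorisation of `B X^{q²} + A X^q + T X` through `X^q - δ^{q-1} X`, for a nonzero root `δ`. -/
theorem torsion_of_pow_eq {L : Type*} [Field L] {p s q : ℕ} (hp : p.Prime) [CharP L p]
    (hq : q = p ^ s) (hq2 : 2 ≤ q) {A B T δ γ η : L} (hB : B ≠ 0) (hδ : δ ≠ 0) (hη : η ≠ 0)
    (hroot : B * δ ^ (q ^ 2 - 1) + A * δ ^ (q - 1) + T = 0) (hγ : γ ^ (q - 1) = T / B)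
    (hηq : η ^ q = δ ^ (q - 1) * η + δ⁻¹ * γ) :
    B * η ^ (q ^ 2 - 1) + A * η ^ (q - 1) + T = 0 := by
  have : Fact p.Prime := ⟨hp⟩
  obtain ⟨k, rfl⟩ : ∃ k, q = k + 1 := ⟨q - 1, by lia⟩
  have hk : (k + 1) ^ 2 - 1 = k * (k + 1) + k := by
    rw [show (k + 1) ^ 2 = k * (k + 1) + k + 1 by ring, Nat.add_sub_cancel]
  rw [hk] at hroot ⊢
  rw [Nat.add_sub_cancel] at hroot hγ hηq ⊢
  have hadd : ∀ x y : L, (x + y) ^ (k + 1) = x ^ (k + 1) + y ^ (k + 1) := fun x y => by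
    rw [hq]; exact add_pow_char_pow x y p s
  have hη2 : η ^ (k * (k + 1) + k) * η =
      δ ^ (k * (k + 1)) * η ^ (k + 1) + (δ⁻¹) ^ (k + 1) * γ ^ k * γ := by
    rw [← pow_succ, show k * (k + 1) + k + 1 = (k + 1) * (k + 1) by ring, pow_mul, hηq, hadd,
      mul_pow, ← hηq, mul_pow, ← pow_mul, mul_assoc, ← pow_succ]
  have hA : A * δ ^ k = -T - B * δ ^ (k * (k + 1)) * δ ^ k := by
    rw [pow_add] at hroot
    linear_combination hroot
  have hδk : δ ^ k ≠ 0 := pow_ne_zero _ hδ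
  have hγ' : B * γ ^ k = T := by rw [hγ]; field_simp
  refine (mul_eq_zero.1 (?_ : (B * η ^ (k * (k + 1) + k) + A * η ^ k + T) * (η * δ ^ k) = 0)
    ).resolve_right (mul_ne_zero hη hδk)
  have hinv : (δ⁻¹) ^ (k + 1) * δ ^ k = δ⁻¹ := by
    rw [pow_succ, inv_pow]; field_simp
  rw [pow_succ] at hη2 hηq
  linear_combination B * δ ^ k * hη2 + η ^ k * η * hA - T * hηq + δ⁻¹ * γ * hγ' +
    B * γ ^ k * γ * hinv

/-- Let `q = p^s` be a prime power, `L` an algebraically closed field extension of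
`𝔽_q(T)`, complete with respect to an additive valuation `v` (valued in
`ℝ ∪ {∞} = ` `EReal`, `v x = ⊤ ↔ x = 0`) with `v T = -1`, and let `A, B ∈ L` with
`B ≠ 0` and `v j < -q` where `j := A^{q+1}/B`.  Let `δ` satisfy
`B δ^{q²-1} + A δ^{q-1} + T = 0` and `v δ = (v A - v B)/(q²-q)`, let `γ^{q-1} = T/B`, and
set `c := δ⁻¹ γ`.  Then `v (c/δ^q) = -(v j + q)/(q²-q) > 0`, the series
`η := -δ ∑_{n≥0} (c/δ^q)^{q^n}` converges in `L`, `v η = -(1 + v A)/(q-1)`, and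
`B η^{q²-1} + A η^{q-1} + T = 0`. -/
theorem eta_series_period_generator (p q s : ℕ) (hp : p.Prime) (hs : 1 ≤ s) (hq : q = p ^ s)
    (L : Type*) [Field L] [CharP L p] [IsAlgClosed L]
    (v : L → EReal) (hv0 : ∀ x : L, v x = ⊤ ↔ x = 0) (hvb : ∀ x : L, v x ≠ ⊥)
    (hvm : ∀ x y : L, v (x * y) = v x + v y)
    (hva : ∀ x y : L, min (v x) (v y) ≤ v (x + y))
    (hcomp : ∀ f : ℕ → L,
      (∀ M : ℝ, ∃ N : ℕ, ∀ m : ℕ, N ≤ m → ∀ n : ℕ, N ≤ n → (M : EReal) < v (f m - f n)) →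
      ∃ x : L, IsVLimit v f x)
    (T : L) (hvT : v T = -1) (A B : L) (hB : B ≠ 0)
    (hj : v (A ^ (q + 1) / B) < ((-(q : ℝ) : ℝ) : EReal))
    (δ : L) (hδroot : B * δ ^ (q ^ 2 - 1) + A * δ ^ (q - 1) + T = 0)
    (hvδ : v δ = (v A - v B) * ((((q : ℝ) ^ 2 - (q : ℝ))⁻¹ : ℝ) : EReal))
    (γ : L) (hγ : γ ^ (q - 1) = T / B) :
    (v (δ⁻¹ * γ / δ ^ q) =
        -(v (A ^ (q + 1) / B) + ((q : ℝ) : EReal)) *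
          ((((q : ℝ) ^ 2 - (q : ℝ))⁻¹ : ℝ) : EReal) ∧
      (0 : EReal) < v (δ⁻¹ * γ / δ ^ q)) ∧
    (∃ η : L,
      IsVLimit v (fun N => -δ * ∑ n ∈ Finset.range N, (δ⁻¹ * γ / δ ^ q) ^ q ^ n) η) ∧
    (∀ η : L,
      IsVLimit v (fun N => -δ * ∑ n ∈ Finset.range N, (δ⁻¹ * γ / δ ^ q) ^ q ^ n) η →
        v η = -(1 + v A) * ((((q : ℝ) - 1)⁻¹ : ℝ) : EReal) ∧
        B * η ^ (q ^ 2 - 1) + A * η ^ (q - 1) + T = 0) := by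
  have h : IsAddVal v := ⟨hv0, hvb, hvm, hva⟩
  have hq2 : 2 ≤ q := by
    rw [hq]
    exact hp.two_le.trans (Nat.le_self_pow (by lia) p)
  have hqR : (2 : ℝ) ≤ q := by exact_mod_cast hq2
  have hA : A ≠ 0 := by
    rintro rfl
    rw [zero_pow (by lia), zero_div, h.map_zero] at hj
    exact not_top_lt hj
  obtain ⟨a, ha⟩ := h.exists_coe hA
  obtain ⟨b, hb⟩ := h.exists_coe hB
  have hvj : v (A ^ (q + 1) / B) = (((q : ℝ) + 1) * a - b : ℝ) := by
    rw [h.map_div_coe (h.map_pow_coe ha (q + 1)) hb]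
    push_cast
    rfl
  have hvδ' : v δ = ((a - b) * ((q : ℝ) ^ 2 - q)⁻¹ : ℝ) := by
    rw [hvδ, ha, hb, ← EReal.coe_sub, ← EReal.coe_mul]
  have hδ : δ ≠ 0 := h.ne_zero_of_coe hvδ'
  have hvT' : v T = (-1 : ℝ) := by rw [hvT]; rfl
  have hvγq := h.map_div_coe hvT' hb
  have hγ0 : γ ≠ 0 := by
    rintro rfl
    rw [zero_pow (by lia)] at hγ
    exact h.ne_zero_of_coe hvγq hγ.symm
  obtain ⟨g, hg⟩ := h.exists_coe hγ0
  have hgeq : ((q : ℝ) - 1) * g = -1 - b := by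
    rw [← hγ, h.map_pow_coe hg, EReal.coe_eq_coe_iff, Nat.cast_sub (by lia), Nat.cast_one] at hvγq
    exact hvγq
  have hq1 : (q : ℝ) - 1 ≠ 0 := by linarith
  have hq0 : (q : ℝ) ≠ 0 := by linarith
  have hqq : (q : ℝ) ^ 2 - q = q * (q - 1) := by ring
  have hgval : g = (-1 - b) / (q - 1) := by rw [eq_div_iff hq1]; linarith
  have hvu : v (δ⁻¹ * γ / δ ^ q) =
      (-(((q : ℝ) + 1) * a - b + q) * ((q : ℝ) ^ 2 - q)⁻¹ : ℝ) := by
    rw [h.map_div_coe (h.map_mul_coe (h.map_inv_coe hvδ') hg) (h.map_pow_coe hvδ' q),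
      EReal.coe_eq_coe_iff, hgval, hqq]
    field_simp
    ring
  rw [hvj, EReal.coe_lt_coe_iff] at hj
  have hpos : 0 < -(((q : ℝ) + 1) * a - b + q) * ((q : ℝ) ^ 2 - q)⁻¹ := by
    refine mul_pos (by linarith) (inv_pos.2 ?_)
    nlinarith
  have hvnδ : v (-δ) = ((a - b) * ((q : ℝ) ^ 2 - q)⁻¹ : ℝ) := by rw [h.map_neg, hvδ']
  refine ⟨⟨?_, ?_⟩, ?_, ?_⟩
  · rw [hvu, hvj, ← EReal.coe_add, ← EReal.coe_neg, ← EReal.coe_mul]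
  · rw [hvu]
    exact_mod_cast hpos
  · exact hcomp _ (h.cauchy_series hvnδ hvu hpos hq2)
  · intro η hη
    have hvη := h.map_limit_series hvnδ hvu hpos hq2 hη
    refine ⟨?_, torsion_of_pow_eq hp hq hq2 hB hδ (h.ne_zero_of_coe hvη) hδroot hγ ?_⟩
    · rw [hvη, ha, ← EReal.coe_one, ← EReal.coe_add, ← EReal.coe_neg, ← EReal.coe_mul,
        EReal.coe_eq_coe_iff, hqq]
      field_simp
      ring
    · rw [h.limit_series_pow hp hq hq2 hvδ' hvu hpos hη, mul_div_cancel₀ _ (pow_ne_zero q hδ)]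
end

section
/- Let q be a power of a prime p, let L be a field extension of 𝔽_q(T), let A, B ∈ L with B ≠ 0, let β_n be the logarithm coefficients of φ_T = T + Aτ + Bτ², and let δ ∈ L be nonzero with B δ^{q²} + A δ^{q} + T δ = 0. Then for every n ≥ 1, T ∑_{j=0}^{n} β_j δ^{q^j} = (Tδ)^{q^n} β_n − (B δ^{q²})^{q^{n−1}} β_{n−1}. -/
/-- Let `q = p^s` be a prime power, `L` a field extension of `𝔽_q(T)` (encoded: `L` of
characteristic `p`, `T ∈ L` with `T^{q^m} ≠ T` for `m ≥ 1`), let `A, B ∈ L` with `B ≠ 0`,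
let `β_n` be the logarithm coefficients of `φ_T = T + A τ + B τ²` (defined by `β_0 = 1`
and `-[n] β_n = A^{q^{n-1}} β_{n-1} + B^{q^{n-2}} β_{n-2}`), and let `δ ≠ 0` satisfy
`B δ^{q²} + A δ^q + T δ = 0`.  Then for every `n ≥ 1`,
`T ∑_{j=0}^n β_j δ^{q^j} = (Tδ)^{q^n} β_n - (B δ^{q²})^{q^{n-1}} β_{n-1}`. -/
theorem partial_sum_telescope (p q s : ℕ) (hp : p.Prime) (hs : 1 ≤ s) (hq : q = p ^ s)
    (L : Type*) [Field L] [CharP L p]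
    (T : L) (hT : ∀ m : ℕ, 1 ≤ m → T ^ q ^ m ≠ T) (A B : L) (hB : B ≠ 0)
    (β : ℕ → L) (hβ0 : β 0 = 1)
    (hβ1 : -(T ^ q ^ 1 - T) * β 1 = A * β 0)
    (hβ : ∀ n : ℕ,
      -(T ^ q ^ (n + 2) - T) * β (n + 2) = A ^ q ^ (n + 1) * β (n + 1) + B ^ q ^ n * β n)
    (δ : L) (hδ0 : δ ≠ 0) (hδ : B * δ ^ q ^ 2 + A * δ ^ q + T * δ = 0) :
    ∀ n : ℕ, 1 ≤ n →
      T * ∑ j ∈ Finset.range (n + 1), β j * δ ^ q ^ j =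
        (T * δ) ^ q ^ n * β n - (B * δ ^ q ^ 2) ^ q ^ (n - 1) * β (n - 1) := by
  have : Fact p.Prime := ⟨hp⟩
  intro n hn
  induction n, hn using Nat.le_induction with
  | base =>
    simp only [Finset.sum_range_succ, Finset.sum_range_zero, hβ0, mul_pow, pow_zero, pow_one,
      Nat.sub_self] at hβ1 ⊢
    linear_combination δ ^ q * hβ1 + hδ
  | succ n hn ih =>
    obtain ⟨k, rfl⟩ := Nat.exists_eq_add_of_le' hn
    have frob : (B * δ ^ q ^ 2) ^ q ^ (k + 1) + (A * δ ^ q) ^ q ^ (k + 1)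
        + (T * δ) ^ q ^ (k + 1) = 0 := by
      have hqp : q ^ (k + 1) = p ^ (s * (k + 1)) := by rw [hq, pow_mul]
      rw [hqp, ← add_pow_char_pow, ← add_pow_char_pow, hδ,
        zero_pow (pow_ne_zero _ hp.ne_zero)]
    have exp_A : (δ ^ q) ^ q ^ (k + 1) = δ ^ q ^ (k + 2) := by
      rw [← pow_mul, ← pow_succ']
    have exp_B : (δ ^ q ^ 2) ^ q ^ k = δ ^ q ^ (k + 2) := by
      rw [← pow_mul, ← pow_add, add_comm]
    rw [Finset.sum_range_succ, mul_add, ih]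
    simp only [Nat.add_sub_cancel]
    simp only [add_assoc, Nat.reduceAdd]
    rw [mul_pow A, exp_A] at frob
    rw [mul_pow B _ (q ^ k), exp_B, mul_pow T δ (q ^ (k + 2))]
    linear_combination δ ^ q ^ (k + 2) * hβ k + β (k + 1) * frob
end

section
/- Let q be a power of a prime p, let L be a field extension of 𝔽_q(T) with additive valuation v satisfying v(T) = −1, let A, B ∈ L with B ≠ 0, let β_n be the logarithm coefficients of φ_T = T + Aτ + Bτ², and set j := A^{q+1}/B. Suppose v(j) < −q and δ ∈ L is nonzero with B δ^{q²} + A δ^{q} + T δ = 0 and v(δ) = (v(A) − v(B))/(q² − q). Define 𝔞_δ(n) := T ∑_{j=0}^{n} β_j δ^{q^j}. Then: (a) if −q² < v(j) < −q, then v(𝔞_δ(n)) = v(δ) − 1 for every n ≥ 0, and for nonzero z ∈ L, v(𝔞_δ(n) z^{q^n}) → ∞ if and only if v(z) > 0; (b) if v(j) < −q², then v(𝔞_δ(n)) = v(δ) − 1 + (q^n − 1)(v(j) + q²)/(q² − q) for every n ≥ 0, and for nonzero z ∈ L, v(𝔞_δ(n) z^{q^n}) → ∞ if and only if v(z) > −(v(j)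 + q²)/(q² − q); (c) if v(j) = −q², then v(𝔞_δ(n)) ≥ v(δ) − 1 for every n ≥ 0, and v(𝔞_δ(n) z^{q^n}) → ∞ whenever v(z) > 0. -/
/-- `𝔞_δ(n) := T ∑_{j=0}^n β_j δ^{q^j}`, the partial-sum coefficients built from the
logarithm coefficients `β` of a rank-2 Drinfeld module. -/
def aDelta (q : ℕ) {L : Type*} [Field L] (T δ : L) (β : ℕ → L) (n : ℕ) : L :=
  T * ∑ j ∈ Finset.range (n + 1), β j * δ ^ q ^ j

/-- An additive valuation on a field with values in `ℝ ∪ {∞}`, regarded inside `EReal`. -/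
structure IsAddValuation {L : Type*} [Field L] (v : L → EReal) : Prop where
  eq_top_iff : ∀ x, v x = ⊤ ↔ x = 0
  ne_bot : ∀ x, v x ≠ ⊥
  map_mul : ∀ x y, v (x * y) = v x + v y
  min_le_map_add : ∀ x y, min (v x) (v y) ≤ v (x + y)

namespace IsAddValuation

variable {L : Type*} [Field L] {v : L → EReal}

theorem exists_coe (hv : IsAddValuation v) {x : L} (hx : x ≠ 0) : ∃ r : ℝ, v x = r :=
  ⟨(v x).toReal, (EReal.coe_toReal (fun h => hx ((hv.eq_top_iff x).1 h)) (hv.ne_bot x)).symm⟩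

theorem ne_zero_of_eq_coe (hv : IsAddValuation v) {x : L} {r : ℝ} (h : v x = r) : x ≠ 0 := by
  intro hx
  rw [(hv.eq_top_iff x).2 hx] at h
  exact EReal.coe_ne_top r h.symm

theorem mul_eq_coe (hv : IsAddValuation v) {x y : L} {r s : ℝ} (hx : v x = r) (hy : v y = s) :
    v (x * y) = ((r + s : ℝ) : EReal) := by
  rw [hv.map_mul, hx, hy, EReal.coe_add]

theorem map_one (hv : IsAddValuation v) : v 1 = ((0 : ℝ) : EReal) := by
  obtain ⟨r, hr⟩ := hv.exists_coe (one_ne_zero (α := L))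
  have h := hv.mul_eq_coe hr hr
  rw [mul_one, hr, EReal.coe_eq_coe_iff] at h
  rw [hr, EReal.coe_eq_coe_iff]
  linarith

theorem map_neg (hv : IsAddValuation v) (x : L) : v (-x) = v x := by
  obtain ⟨r, hr⟩ := hv.exists_coe (neg_ne_zero.2 (one_ne_zero (α := L)))
  have h := hv.mul_eq_coe hr hr
  rw [neg_mul_neg, one_mul, hv.map_one, EReal.coe_eq_coe_iff] at h
  have h0 : r = 0 := by linarith
  rw [← neg_one_mul, hv.map_mul, hr, h0, EReal.coe_zero, zero_add]

theorem pow_eq_coe (hv : IsAddValuation v) {x : L} {r : ℝ} (hx : v x = r) (n : ℕ) :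
    v (x ^ n) = ((n * r : ℝ) : EReal) := by
  induction n with
  | zero => simpa using hv.map_one
  | succ n ih =>
    rw [pow_succ, hv.mul_eq_coe ih hx, EReal.coe_eq_coe_iff]
    push_cast
    ring

theorem eq_coe_of_mul_eq (hv : IsAddValuation v) {x y z : L} {r t : ℝ} (h : x * y = z)
    (hx : v x = r) (hz : v z = t) : v y = ((t - r : ℝ) : EReal) := by
  have hy : y ≠ 0 := by
    rintro rfl
    exact hv.ne_zero_of_eq_coe hz (by rw [← h, mul_zero])
  obtain ⟨s, hs⟩ := hv.exists_coe hy
  have h1 := hv.mul_eq_coe hx hs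
  rw [h, hz, EReal.coe_eq_coe_iff] at h1
  rw [hs, EReal.coe_eq_coe_iff]
  linarith

theorem map_add_eq_of_lt (hv : IsAddValuation v) {x y : L} (h : v x < v y) :
    v (x + y) = v x := by
  apply le_antisymm
  · by_contra! hlt
    have h1 := hv.min_le_map_add (x + y) (-y)
    rw [hv.map_neg, add_neg_cancel_right] at h1
    exact absurd h1 (not_le.2 (lt_min hlt h))
  · simpa [min_eq_left h.le] using hv.min_le_map_add x y

theorem map_pow_sub_self (hv : IsAddValuation v) {T : L} (hT : v T = ((-1 : ℝ) : EReal))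
    {m : ℕ} (hm : 1 < m) : v (-(T ^ m - T)) = ((-m : ℝ) : EReal) := by
  have hm' : (1 : ℝ) < m := by exact_mod_cast hm
  have hpow := hv.pow_eq_coe hT m
  rw [hv.map_neg, sub_eq_add_neg, hv.map_add_eq_of_lt, hpow, mul_neg_one]
  rw [hpow, hv.map_neg, hT, EReal.coe_lt_coe_iff]
  linarith

theorem map_sum_eq_first (hv : IsAddValuation v) {t : ℕ → L}
    (ht : ∀ n, v (t 0) < v (t (n + 1))) (n : ℕ) :
    v (∑ i ∈ Finset.range (n + 1), t i) = v (t 0) := by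
  induction n with
  | zero => simp
  | succ n ih => rw [Finset.sum_range_succ, hv.map_add_eq_of_lt (by rw [ih]; exact ht n), ih]

theorem map_sum_eq_last (hv : IsAddValuation v) {t : ℕ → L}
    (ht : ∀ n, v (t (n + 1)) < v (t n)) (n : ℕ) :
    v (∑ i ∈ Finset.range (n + 1), t i) = v (t n) := by
  induction n with
  | zero => simp
  | succ n ih =>
    rw [Finset.sum_range_succ, add_comm, hv.map_add_eq_of_lt (by rw [ih]; exact ht n)]

theorem le_map_sum (hv : IsAddValuation v) {t : ℕ → L} {c : EReal} (ht : ∀ n, c ≤ v (t n))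
    (n : ℕ) : c ≤ v (∑ i ∈ Finset.range (n + 1), t i) := by
  induction n with
  | zero => simpa using ht 0
  | succ n ih =>
    rw [Finset.sum_range_succ]
    exact (le_min ih (ht _)).trans (hv.min_le_map_add _ _)

/-- The valuations of the logarithm coefficients when `v j < -q`: the term with `A` dominates
the recursion at every step. -/
theorem logCoeff_eq_coe (hv : IsAddValuation v) {q : ℕ} (hq : 2 ≤ q) {T A B : L} {β : ℕ → L}
    {a b : ℝ} (hT : v T = ((-1 : ℝ) : EReal)) (hA : v A = a) (hB : v B = b)
    (hj : (q + 1) * a - b < -q) (hβ0 : β 0 = 1)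
    (hβ1 : -(T ^ q ^ 1 - T) * β 1 = A * β 0)
    (hβ : ∀ n : ℕ,
      -(T ^ q ^ (n + 2) - T) * β (n + 2) = A ^ q ^ (n + 1) * β (n + 1) + B ^ q ^ n * β n)
    (n : ℕ) : v (β n) = (((a + q) * ((q ^ n - 1) / (q - 1)) : ℝ) : EReal) := by
  have hq' : (2 : ℝ) ≤ q := by exact_mod_cast hq
  have hq1 : (q : ℝ) - 1 ≠ 0 := by linarith
  have hbracket (m : ℕ) : v (-(T ^ q ^ (m + 1) - T)) = ((-(q ^ (m + 1) : ℕ) : ℝ) : EReal) :=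
    hv.map_pow_sub_self hT (Nat.one_lt_pow m.succ_ne_zero hq)
  induction n using Nat.twoStepInduction with
  | zero => simpa [hβ0] using hv.map_one
  | one =>
    rw [hv.eq_coe_of_mul_eq hβ1 (hbracket 0) (by rw [hβ0, mul_one, hA]), EReal.coe_eq_coe_iff]
    push_cast
    field_simp
    ring
  | more n ih0 ih1 =>
    have h1 := hv.mul_eq_coe (hv.pow_eq_coe hA (q ^ (n + 1))) ih1
    have h0 := hv.mul_eq_coe (hv.pow_eq_coe hB (q ^ n)) ih0
    have hlt : v (A ^ q ^ (n + 1) * β (n + 1)) < v (B ^ q ^ n * β n) := by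
      rw [h1, h0, EReal.coe_lt_coe_iff, ← sub_neg]
      have hdiff : ((q ^ (n + 1) : ℕ) : ℝ) * a + (a + q) * ((q ^ (n + 1) - 1) / (q - 1)) -
          (((q ^ n : ℕ) : ℝ) * b + (a + q) * ((q ^ n - 1) / (q - 1))) =
          q ^ n * ((q + 1) * a - b + q) := by
        push_cast
        field_simp
        ring
      rw [hdiff]
      exact mul_neg_of_pos_of_neg (by positivity) (by linarith)
    rw [hv.eq_coe_of_mul_eq (hβ n) (hbracket (n + 1)) ((hv.map_add_eq_of_lt hlt).trans h1),
      EReal.coe_eq_coe_iff]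
    push_cast
    field_simp
    ring

end IsAddValuation

theorem eventually_lt_add_pow_mul_iff {q : ℕ} (hq : 2 ≤ q) (c e : ℝ) :
    (∀ M : ℝ, ∃ N : ℕ, ∀ n : ℕ, N ≤ n → M < c + q ^ n * e) ↔ 0 < e := by
  have hq' : (1 : ℝ) < q := by exact_mod_cast hq
  constructor
  · intro h
    obtain ⟨N, hN⟩ := h c
    have h1 := hN N le_rfl
    exact pos_of_mul_pos_right (by linarith) (by positivity : (0 : ℝ) ≤ q ^ N)
  · intro he M
    obtain ⟨N, hN⟩ := pow_unbounded_of_one_lt ((M - c) / e) hq'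
    refine ⟨N, fun n hn => ?_⟩
    have h1 : (q : ℝ) ^ N ≤ q ^ n := pow_le_pow_right₀ hq'.le hn
    have h2 := (div_lt_iff₀ he).1 (hN.trans_le h1)
    linarith

/-- Let `q = p^s` be a prime power, `L` a field extension of `𝔽_q(T)` with additive
valuation `v` (valued in `ℝ ∪ {∞} = ` `EReal`, `v x = ⊤ ↔ x = 0`) with `v T = -1`, let
`β_n` be the logarithm coefficients of `φ_T = T + A τ + B τ²` (`B ≠ 0`), suppose
`v j < -q` where `j := A^{q+1}/B`, and let `δ ≠ 0` satisfy `B δ^{q²} + A δ^q + T δ = 0`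
and `v δ = (v A - v B)/(q²-q)`.  With `𝔞_δ(n) := T ∑_{j=0}^n β_j δ^{q^j}`:
(a) if `-q² < v j`, then `v (𝔞_δ(n)) = v δ - 1` for all `n`, and for `z ≠ 0`,
    `v (𝔞_δ(n) z^{q^n}) → ∞` iff `v z > 0`;
(b) if `v j < -q²`, then `v (𝔞_δ(n)) = v δ - 1 + (q^n - 1)(v j + q²)/(q²-q)` for all `n`,
    and for `z ≠ 0`, `v (𝔞_δ(n) z^{q^n}) → ∞` iff `v z > -(v j + q²)/(q²-q)`;
(c) if `v j = -q²`, then `v (𝔞_δ(n)) ≥ v δ - 1` for all `n`, and `v (𝔞_δ(n) z^{q^n}) → ∞`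
    whenever `v z > 0`. -/
theorem aDelta_valuation (p q s : ℕ) (hp : p.Prime) (hs : 1 ≤ s) (hq : q = p ^ s)
    (L : Type*) [Field L] [CharP L p]
    (v : L → EReal) (hv0 : ∀ x : L, v x = ⊤ ↔ x = 0) (hvb : ∀ x : L, v x ≠ ⊥)
    (hvm : ∀ x y : L, v (x * y) = v x + v y)
    (hva : ∀ x y : L, min (v x) (v y) ≤ v (x + y))
    (T : L) (hvT : v T = -1) (A B : L) (hB : B ≠ 0)
    (β : ℕ → L) (hβ0 : β 0 = 1)
    (hβ1 : -(T ^ q ^ 1 - T) * β 1 = A * β 0)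
    (hβ : ∀ n : ℕ,
      -(T ^ q ^ (n + 2) - T) * β (n + 2) = A ^ q ^ (n + 1) * β (n + 1) + B ^ q ^ n * β n)
    (hj : v (A ^ (q + 1) / B) < ((-(q : ℝ) : ℝ) : EReal))
    (δ : L) (hδ0 : δ ≠ 0) (hδroot : B * δ ^ q ^ 2 + A * δ ^ q + T * δ = 0)
    (hvδ : v δ = (v A - v B) * ((((q : ℝ) ^ 2 - (q : ℝ))⁻¹ : ℝ) : EReal)) :
    (((-((q : ℝ) ^ 2) : ℝ) : EReal) < v (A ^ (q + 1) / B) →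
      (∀ n : ℕ, v (aDelta q T δ β n) = v δ - 1) ∧
      (∀ z : L, z ≠ 0 →
        ((∀ M : ℝ, ∃ N : ℕ, ∀ n : ℕ, N ≤ n →
            (M : EReal) < v (aDelta q T δ β n * z ^ q ^ n)) ↔ (0 : EReal) < v z))) ∧
    (v (A ^ (q + 1) / B) < ((-((q : ℝ) ^ 2) : ℝ) : EReal) →
      (∀ n : ℕ, v (aDelta q T δ β n) =
        v δ - 1 +
          ((((q : ℝ) ^ n - 1) : ℝ) : EReal) *
            ((v (A ^ (q + 1) / B) + (((q : ℝ) ^ 2 : ℝ) : EReal)) *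
              ((((q : ℝ) ^ 2 - (q : ℝ))⁻¹ : ℝ) : EReal))) ∧
      (∀ z : L, z ≠ 0 →
        ((∀ M : ℝ, ∃ N : ℕ, ∀ n : ℕ, N ≤ n →
            (M : EReal) < v (aDelta q T δ β n * z ^ q ^ n)) ↔
          -(v (A ^ (q + 1) / B) + (((q : ℝ) ^ 2 : ℝ) : EReal)) *
              ((((q : ℝ) ^ 2 - (q : ℝ))⁻¹ : ℝ) : EReal) < v z))) ∧
    (v (A ^ (q + 1) / B) = ((-((q : ℝ) ^ 2) : ℝ) : EReal) →
      (∀ n : ℕ, v δ - 1 ≤ v (aDelta q T δ β n)) ∧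
      (∀ z : L, z ≠ 0 → (0 : EReal) < v z →
        ∀ M : ℝ, ∃ N : ℕ, ∀ n : ℕ, N ≤ n →
          (M : EReal) < v (aDelta q T δ β n * z ^ q ^ n))) := by
  have hv : IsAddValuation v := ⟨hv0, hvb, hvm, hva⟩
  have hq2 : 2 ≤ q := hq ▸ hp.two_le.trans (Nat.le_self_pow (by omega) p)
  have hq2' : (2 : ℝ) ≤ q := by exact_mod_cast hq2
  have hq1 : (q : ℝ) - 1 ≠ 0 := by linarith
  have hqq : 0 < (q : ℝ) ^ 2 - q := by nlinarith
  have hT : v T = ((-1 : ℝ) : EReal) := by rw [hvT]; rfl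
  have hA0 : A ≠ 0 := by
    rintro rfl
    rw [zero_pow q.succ_ne_zero, zero_div, (hv0 0).2 rfl] at hj
    exact not_top_lt hj
  obtain ⟨a, hA⟩ := hv.exists_coe hA0
  obtain ⟨b, hBb⟩ := hv.exists_coe hB
  obtain ⟨d, hd⟩ := hv.exists_coe hδ0
  have hJ : v (A ^ (q + 1) / B) = (((q + 1) * a - b : ℝ) : EReal) := by
    rw [hv.eq_coe_of_mul_eq (mul_div_cancel₀ _ hB) hBb (hv.pow_eq_coe hA (q + 1))]
    push_cast
    rfl
  rw [hJ, EReal.coe_lt_coe_iff] at hj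
  rw [hd, hA, hBb, ← EReal.coe_sub, ← EReal.coe_mul, EReal.coe_eq_coe_iff] at hvδ
  set J : ℝ := (q + 1) * a - b with hJdef
  set c : ℝ := (J + q ^ 2) * ((q : ℝ) ^ 2 - q)⁻¹ with hc
  have hterm (n : ℕ) : v (β n * δ ^ q ^ n) = ((d + (q ^ n - 1) * c : ℝ) : EReal) := by
    rw [hv.mul_eq_coe (hv.logCoeff_eq_coe hq2 hT hA hBb hj hβ0 hβ1 hβ n)
      (hv.pow_eq_coe hd (q ^ n)), EReal.coe_eq_coe_iff, hc, hJdef, hvδ]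
    have hfac : (q : ℝ) ^ 2 - q = q * (q - 1) := by ring
    rw [hfac]
    push_cast
    field_simp
    ring
  have hterm0 : v (β 0 * δ ^ q ^ 0) = d := by rw [hterm 0]; simp
  have hpow1 (n : ℕ) : (1 : ℝ) < q ^ (n + 1) := one_lt_pow₀ (by linarith) n.succ_ne_zero
  have hpowlt (n : ℕ) : (q : ℝ) ^ n < q ^ (n + 1) :=
    pow_lt_pow_right₀ (by linarith) n.lt_succ_self
  have hlimit (z : L) (r e k : ℝ) (hz : v z = r)
      (hval : ∀ n, v (aDelta q T δ β n) = ((k + q ^ n * e : ℝ) : EReal)) :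
      (∀ M : ℝ, ∃ N : ℕ, ∀ n : ℕ, N ≤ n →
        (M : EReal) < v (aDelta q T δ β n * z ^ q ^ n)) ↔ 0 < e + r := by
    rw [← eventually_lt_add_pow_mul_iff hq2 k]
    have heq (n : ℕ) : v (aDelta q T δ β n * z ^ q ^ n) =
        ((k + q ^ n * (e + r) : ℝ) : EReal) := by
      rw [hv.mul_eq_coe (hval n) (hv.pow_eq_coe hz (q ^ n)), EReal.coe_eq_coe_iff]
      push_cast
      ring
    simp only [heq, EReal.coe_lt_coe_iff]
  have hd1 : v δ - 1 = ((d - 1 : ℝ) : EReal) := by rw [hd]; rfl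
  rw [hd1, hJ]
  refine ⟨fun hlow => ?_, fun hup => ?_, fun hcrit => ?_⟩
  · rw [EReal.coe_lt_coe_iff] at hlow
    have hcpos : 0 < c := mul_pos (by linarith) (inv_pos.2 hqq)
    have hval (n : ℕ) : v (aDelta q T δ β n) = ((d - 1 : ℝ) : EReal) := by
      have hsum := (hv.map_sum_eq_first (t := fun i => β i * δ ^ q ^ i) (fun m => by
        rw [hterm0, hterm, EReal.coe_lt_coe_iff]
        nlinarith [hpow1 m]) n).trans hterm0
      rw [aDelta, hv.mul_eq_coe hT hsum, neg_add_eq_sub]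
    refine ⟨hval, fun z hz => ?_⟩
    obtain ⟨r, hr⟩ := hv.exists_coe hz
    rw [hlimit z r 0 (d - 1) hr (by simpa using hval), hr, zero_add, EReal.coe_pos]
  · rw [EReal.coe_lt_coe_iff] at hup
    have hcneg : c < 0 := mul_neg_of_neg_of_pos (by linarith) (inv_pos.2 hqq)
    have hval (n : ℕ) : v (aDelta q T δ β n) = ((d - 1 + (q ^ n - 1) * c : ℝ) : EReal) := by
      have hsum := (hv.map_sum_eq_last (t := fun i => β i * δ ^ q ^ i) (fun m => by
        rw [hterm, hterm, EReal.coe_lt_coe_iff]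
        nlinarith [hpowlt m]) n).trans (hterm n)
      rw [aDelta, hv.mul_eq_coe hT hsum, EReal.coe_eq_coe_iff]
      ring
    refine ⟨fun n => ?_, fun z hz => ?_⟩
    · rw [hval n, ← EReal.coe_add, ← EReal.coe_mul, ← EReal.coe_mul, ← EReal.coe_add]
    · obtain ⟨r, hr⟩ := hv.exists_coe hz
      rw [hlimit z r c (d - 1 - c) hr fun n => by
        rw [hval n, EReal.coe_eq_coe_iff]
        ring]
      rw [hr, ← EReal.coe_add, ← EReal.coe_neg, ← EReal.coe_mul, EReal.coe_lt_coe_iff,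
        neg_mul, ← hc, neg_lt_iff_pos_add']
  · rw [EReal.coe_eq_coe_iff] at hcrit
    have hczero : c = 0 := by rw [hc, hcrit, neg_add_cancel, zero_mul]
    have hval (n : ℕ) : ((d - 1 : ℝ) : EReal) ≤ v (aDelta q T δ β n) := by
      have hsum := hv.le_map_sum (t := fun i => β i * δ ^ q ^ i) (c := d) (fun m => by
        rw [hterm, hczero, mul_zero, add_zero]) n
      rw [aDelta, hvm, hT, sub_eq_neg_add, EReal.coe_add]
      exact add_le_add_right hsum _
    refine ⟨hval, fun z hz hzpos M => ?_⟩
    obtain ⟨r, hr⟩ := hv.exists_coe hz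
    rw [hr, EReal.coe_pos] at hzpos
    obtain ⟨N, hN⟩ := (eventually_lt_add_pow_mul_iff hq2 (d - 1) r).2 hzpos M
    refine ⟨N, fun n hn => ?_⟩
    rw [hvm, hv.pow_eq_coe hr (q ^ n)]
    refine lt_of_lt_of_le ?_ (add_le_add_left (hval n) _)
    rw [← EReal.coe_add, EReal.coe_lt_coe_iff]
    push_cast
    exact hN n hn
end

section
/- Let q = p^s be a power of a prime p, let L be a field of characteristic p containing 𝔽_q, let T ∈ L, let r ≥ 1, and let A_1,…,A_r ∈ L. Define c(n;m) ∈ L for n ∈ ℤ, m ≥ 0 by c(0;0) = 1, c(n;0) = 0 for n ≠ 0, c(n;m) = 0 for n < 0, and c(n;m+1) = T·c(n;m) + ∑_{i=1}^{r} A_i · c(n−i;m)^{q^i}; these are the coefficients of τ^n in φ_{T^m} for the rank-r Drinfeld module φ_T = T + A_1τ + … + A_rτ^r. Then for all m ≥ 0 and n ≥ 0, c(n;m) = ∑_{S ∈ P_r(n)} A^S · h_{m−|S|}^{(∪S ∪ {n})}. -/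
/-- `SP r n S`: the `r`-tuple `S` (with `S i` playing the role of `S_{i+1}`) of subsets of
`{0, …, n-1}` is an order-`r` shadowed partition of `n`. -/
def SP (r n : ℕ) (S : Fin r → Finset ℕ) : Prop :=
  (∀ p q : Σ i : Fin r, Fin ((i : ℕ) + 1), p ≠ q →
      Disjoint ((S p.1).image (· + (p.2 : ℕ))) ((S q.1).image (· + (q.2 : ℕ)))) ∧
    (Finset.univ : Finset (Σ i : Fin r, Fin ((i : ℕ) + 1))).biUnion
        (fun p => (S p.1).image (· + (p.2 : ℕ))) = Finset.range n

/-- `P_r(n)` as a finite set: all order-`r` shadowed partitions of `n`. -/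
noncomputable def SPart (r n : ℕ) : Finset (Fin r → Finset ℕ) :=
  @Finset.filter _ (fun S => SP r n S) (Classical.decPred _)
    (Fintype.piFinset fun _ : Fin r => (Finset.range n).powerset)

/-- `h_n^S := ∑ T^{∑_{i ∈ S} k_i q^i}`, the sum over all tuples `(k_i)_{i ∈ S}` of
nonnegative integers with `∑_{i ∈ S} k_i = n` (so `h_n^S = 0` for `n < 0` and
`h_0^S = 1`). -/
noncomputable def hpoly (q : ℕ) {L : Type*} [Field L] (T : L) (S : Finset ℕ) (n : ℤ) : L :=
  if 0 ≤ n then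
    ∑ k ∈ (Fintype.piFinset fun _ : ↥S => Finset.range (n.toNat + 1)).filter
        (fun k => (∑ i, k i) = n.toNat),
      T ^ (∑ i : ↥S, k i * q ^ (i : ℕ))
  else 0

open PowerSeries in
/-- The complete homogeneous sums `hpoly q T S n` are the coefficients of
`∏_{i ∈ S} 1 / (1 - T^{q^i} X)`. -/
theorem hpoly_natCast_eq_coeff (q : ℕ) {L : Type*} [Field L] (T : L) (S : Finset ℕ) (n : ℕ) :
    hpoly q T S n = coeff n (∏ i ∈ S, PowerSeries.mk fun k => (T ^ q ^ i) ^ k) := by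
  classical
  rw [← Finset.prod_coe_sort S, coeff_prod, hpoly, if_pos (by positivity)]
  symm
  refine Finset.sum_bij' (fun l _ => ⇑l) (fun k _ => Finsupp.equivFunOnFinite.symm k)
    ?_ ?_ ?_ ?_ ?_
  · intro l hl
    rw [Finset.mem_finsuppAntidiag] at hl
    simp only [Finset.mem_filter, Fintype.mem_piFinset, Finset.mem_range, Int.toNat_natCast]
    refine ⟨fun i => Nat.lt_succ_of_le ?_, hl.1⟩
    rw [← hl.1]
    exact Finset.single_le_sum (fun _ _ => Nat.zero_le _) (Finset.mem_univ i)
  · intro k hk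
    simp only [Finset.mem_filter, Int.toNat_natCast] at hk
    exact Finset.mem_finsuppAntidiag.2 ⟨hk.2, Finset.subset_univ _⟩
  · intro l _
    ext i
    simp
  · intro k _
    ext i
    simp
  · intro l _
    simp only [coeff_mk]
    rw [← Finset.prod_pow_eq_pow_sum]
    exact Finset.prod_congr rfl fun i _ => by rw [← pow_mul, mul_comm]

theorem hpoly_of_neg (q : ℕ) {L : Type*} [Field L] (T : L) (S : Finset ℕ) {n : ℤ} (hn : n < 0) :
    hpoly q T S n = 0 := by
  rw [hpoly, if_neg (by omega)]

open PowerSeries in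
/-- The Pascal-type recursion obtained by lowering the multiplicity of the index `0`. -/
theorem hpoly_insert_zero (q : ℕ) {L : Type*} [Field L] (T : L) {S : Finset ℕ} (hS : 0 ∉ S)
    (n : ℤ) :
    hpoly q T (insert 0 S) (n + 1) = T * hpoly q T (insert 0 S) n + hpoly q T S (n + 1) := by
  have geom : (PowerSeries.mk fun k => T ^ k) = 1 + X * (C T * PowerSeries.mk fun k => T ^ k) := by
    ext k
    cases k with
    | zero => simp
    | succ k => simp [coeff_succ_X_mul, pow_succ', coeff_one]
  have key : (∏ i ∈ insert 0 S, PowerSeries.mk fun k => (T ^ q ^ i) ^ k) =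
      X * (C T * ∏ i ∈ insert 0 S, PowerSeries.mk fun k => (T ^ q ^ i) ^ k) +
        ∏ i ∈ S, PowerSeries.mk fun k => (T ^ q ^ i) ^ k := by
    rw [Finset.prod_insert hS]
    simp only [pow_zero, pow_one]
    nth_rewrite 1 [geom]
    ring
  rcases lt_trichotomy (n + 1) 0 with h | h | h
  · simp [hpoly_of_neg q T _ h, hpoly_of_neg q T _ (show n < 0 by omega)]
  · rw [h, hpoly_of_neg q T _ (show n < 0 by omega), ← Int.natCast_zero,
      hpoly_natCast_eq_coeff, hpoly_natCast_eq_coeff, key]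
    simp
  · obtain ⟨k, rfl⟩ := Int.eq_ofNat_of_zero_le (show 0 ≤ n by omega)
    have e : ((k : ℤ) + 1) = ((k + 1 : ℕ) : ℤ) := by push_cast; rfl
    rw [e, hpoly_natCast_eq_coeff, hpoly_natCast_eq_coeff, hpoly_natCast_eq_coeff, key, map_add,
      coeff_succ_X_mul, coeff_C_mul, ← key]

open PowerSeries in
/-- If `x ↦ x ^ q ^ d` is a ring endomorphism, translating the index set by `d` raises
`hpoly` to the power `q ^ d`. -/
theorem hpoly_image_add (q : ℕ) {L : Type*} [Field L] (T : L) (S : Finset ℕ) (n : ℤ) (d : ℕ)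
    (F : L →+* L) (hF : ∀ x, F x = x ^ q ^ d) :
    hpoly q T (S.image (· + d)) n = F (hpoly q T S n) := by
  rcases lt_or_ge n 0 with h | h
  · rw [hpoly_of_neg q T _ h, hpoly_of_neg q T _ h, map_zero]
  · obtain ⟨k, rfl⟩ := Int.eq_ofNat_of_zero_le h
    rw [hpoly_natCast_eq_coeff, hpoly_natCast_eq_coeff,
      Finset.prod_image fun a _ b _ hab => Nat.add_right_cancel hab, ← coeff_map,
      map_prod (PowerSeries.map F)]
    congr 1
    refine Finset.prod_congr rfl fun i _ => ?_
    ext j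
    simp only [coeff_mk, coeff_map, hF]
    rw [pow_add]
    ring

/-- A tuple is a shadowed partition of `n` iff the intervals `[s, s + i]`, `s ∈ S i`, are
pairwise disjoint and cover exactly `{0, …, n - 1}`. -/
theorem SP_iff {r n : ℕ} {S : Fin r → Finset ℕ} :
    SP r n S ↔
      (∀ x (k : Fin r), ∀ s ∈ S k, ∀ k' : Fin r, ∀ s' ∈ S k', s ≤ x → x ≤ s + k →
        s' ≤ x → x ≤ s' + k' → k = k' ∧ s = s') ∧
      ∀ x, (∃ k : Fin r, ∃ s ∈ S k, s ≤ x ∧ x ≤ s + k) ↔ x < n := by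
  unfold SP
  refine and_congr ?_ ?_
  · constructor
    · intro h x k s hs k' s' hs' h1 h2 h3 h4
      by_cases e : (⟨k, ⟨x - s, by omega⟩⟩ : Σ i : Fin r, Fin ((i : ℕ) + 1)) =
          ⟨k', ⟨x - s', by omega⟩⟩
      · rw [Sigma.mk.injEq] at e
        obtain ⟨rfl, e⟩ := e
        have : x - s = x - s' := congrArg Fin.val (eq_of_heq e)
        exact ⟨rfl, by omega⟩
      · exfalso
        have hx : x ∈ (S k).image (· + (x - s)) := Finset.mem_image.2 ⟨s, hs, by omega⟩
        have hx' : x ∈ (S k').image (· + (x - s')) := Finset.mem_image.2 ⟨s', hs', by omega⟩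
        exact Finset.disjoint_left.1 (h _ _ e) hx hx'
    · rintro h ⟨k, j⟩ ⟨k', j'⟩ hne
      rw [Finset.disjoint_left]
      intro x hx hx'
      obtain ⟨s, hs, rfl⟩ := Finset.mem_image.1 hx
      obtain ⟨s', hs', e⟩ := Finset.mem_image.1 hx'
      dsimp only at *
      obtain ⟨rfl, rfl⟩ := h (s + j) k s hs k' s' hs' (by omega) (by omega) (by omega) (by omega)
      apply hne
      congr 1
      apply Fin.ext
      omega
  · rw [Finset.ext_iff]
    refine forall_congr' fun x => ?_
    rw [Finset.mem_range]
    refine iff_congr ?_ Iff.rfl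
    simp only [Finset.mem_biUnion, Finset.mem_univ, true_and, Finset.mem_image]
    constructor
    · rintro ⟨⟨k, j⟩, s, hs, rfl⟩
      exact ⟨k, s, hs, by dsimp only; omega, by dsimp only; omega⟩
    · rintro ⟨k, s, hs, h1, h2⟩
      exact ⟨⟨k, ⟨x - s, by omega⟩⟩, s, hs, by dsimp only; omega⟩

theorem mem_SPart {r n : ℕ} {S : Fin r → Finset ℕ} : S ∈ SPart r n ↔ SP r n S := by
  classical
  rw [SPart, Finset.mem_filter]
  refine ⟨And.right, fun h => ⟨?_, h⟩⟩
  rw [Fintype.mem_piFinset]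
  intro k
  rw [Finset.mem_powerset]
  intro s hs
  exact Finset.mem_range.2 (((SP_iff.1 h).2 s).1 ⟨k, s, hs, le_rfl, by omega⟩)

/-- Translate a tuple by `i + 1` and put the block `{0, …, i}` in front of it. -/
def consBlock {r : ℕ} (i : Fin r) (S : Fin r → Finset ℕ) (k : Fin r) : Finset ℕ :=
  if k = i then insert 0 ((S k).image (· + ((i : ℕ) + 1))) else (S k).image (· + ((i : ℕ) + 1))

theorem mem_consBlock {r : ℕ} {i k : Fin r} {S : Fin r → Finset ℕ} {x : ℕ} :
    x ∈ consBlock i S k ↔ (k = i ∧ x = 0) ∨ ∃ s ∈ S k, s + ((i : ℕ) + 1) = x := by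
  unfold consBlock
  split_ifs with h <;> simp [h]

theorem add_mem_consBlock {r : ℕ} {i k : Fin r} {S : Fin r → Finset ℕ} {s : ℕ} :
    s + ((i : ℕ) + 1) ∈ consBlock i S k ↔ s ∈ S k := by
  rw [mem_consBlock]
  constructor
  · rintro (⟨_, h⟩ | ⟨s', hs', h⟩)
    · omega
    · obtain rfl : s' = s := by omega
      exact hs'
  · exact fun h => Or.inr ⟨s, h, rfl⟩

theorem zero_mem_consBlock {r : ℕ} {i k : Fin r} {S : Fin r → Finset ℕ} :
    0 ∈ consBlock i S k ↔ k = i := by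
  rw [mem_consBlock]
  constructor
  · rintro (⟨h, _⟩ | ⟨s', hs', h⟩)
    · exact h
    · omega
  · exact fun h => Or.inl ⟨h, rfl⟩

theorem consBlock_injective {r : ℕ} (i : Fin r) : Function.Injective (consBlock i) := by
  intro S S' h
  ext k s
  rw [← add_mem_consBlock (i := i), h, add_mem_consBlock]

theorem SP_consBlock_iff {r n : ℕ} {i : Fin r} {S : Fin r → Finset ℕ} :
    SP r (n + ((i : ℕ) + 1)) (consBlock i S) ↔ SP r n S := by
  rw [SP_iff, SP_iff]
  constructor
  · rintro ⟨h1, h2⟩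
    constructor
    · intro x k s hs k' s' hs' a b c d
      have := h1 (x + (i + 1)) k _ (add_mem_consBlock.2 hs) k' _ (add_mem_consBlock.2 hs')
        (by omega) (by omega) (by omega) (by omega)
      exact ⟨this.1, by omega⟩
    · intro x
      rw [← Nat.add_lt_add_iff_right (k := (i : ℕ) + 1), ← h2]
      constructor
      · rintro ⟨k, s, hs, a, b⟩
        exact ⟨k, _, add_mem_consBlock.2 hs, by omega, by omega⟩
      · rintro ⟨k, s, hs, a, b⟩
        obtain ⟨rfl, rfl⟩ | ⟨s', hs', rfl⟩ := mem_consBlock.1 hs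
        · omega
        · exact ⟨k, s', hs', by omega, by omega⟩
  · rintro ⟨h1, h2⟩
    constructor
    · intro x k s hs k' s' hs' a b c d
      obtain ⟨rfl, rfl⟩ | ⟨t, ht, rfl⟩ := mem_consBlock.1 hs <;>
        obtain ⟨rfl, rfl⟩ | ⟨t', ht', rfl⟩ := mem_consBlock.1 hs'
      · exact ⟨rfl, rfl⟩
      · omega
      · omega
      · have := h1 (x - (i + 1)) k t ht k' t' ht' (by omega) (by omega) (by omega) (by omega)
        exact ⟨this.1, by omega⟩
    · intro x
      rcases lt_or_ge x ((i : ℕ) + 1) with hx | hx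
      · exact iff_of_true ⟨i, 0, zero_mem_consBlock.2 rfl, by omega, by omega⟩ (by omega)
      · obtain ⟨y, rfl⟩ := Nat.exists_eq_add_of_le' hx
        rw [Nat.add_lt_add_iff_right, ← h2]
        constructor
        · rintro ⟨k, s, hs, a, b⟩
          obtain ⟨rfl, rfl⟩ | ⟨s', hs', rfl⟩ := mem_consBlock.1 hs
          · omega
          · exact ⟨k, s', hs', by omega, by omega⟩
        · rintro ⟨k, s, hs, a, b⟩
          exact ⟨k, _, add_mem_consBlock.2 hs, by omega, by omega⟩

/-- A shadowed partition of a positive integer begins with a unique block. -/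
theorem SP.exists_consBlock {r n : ℕ} {S : Fin r → Finset ℕ} (h : SP r n S) (hn : 0 < n) :
    ∃ (i : Fin r) (n' : ℕ) (S' : Fin r → Finset ℕ),
      n = n' + ((i : ℕ) + 1) ∧ S = consBlock i S' := by
  obtain ⟨h1, h2⟩ := SP_iff.1 h
  obtain ⟨i, s, hs, hs0, -⟩ := (h2 0).2 hn
  obtain rfl : s = 0 := by omega
  have hi : (i : ℕ) < n := (h2 i).1 ⟨i, 0, hs, by omega, by omega⟩
  refine ⟨i, n - (i + 1), fun k => (S k).preimage (· + ((i : ℕ) + 1))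
    (add_left_injective _).injOn, by omega, ?_⟩
  ext k x
  rw [mem_consBlock]
  constructor
  · intro hx
    rcases lt_or_ge x ((i : ℕ) + 1) with hxi | hxi
    · have := h1 x k x hx i 0 hs le_rfl (by omega) (by omega) (by omega)
      exact Or.inl this
    · obtain ⟨y, rfl⟩ := Nat.exists_eq_add_of_le' hxi
      exact Or.inr ⟨y, Finset.mem_preimage.2 hx, rfl⟩
  · rintro (⟨rfl, rfl⟩ | ⟨s, hs, rfl⟩)
    · exact hs
    · rwa [Finset.mem_preimage] at hs

theorem SPart_eq_biUnion {r n : ℕ} (hn : 0 < n) :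
    SPart r n = (Finset.univ : Finset (Fin r)).biUnion fun i =>
      (if (i : ℕ) + 1 ≤ n then SPart r (n - ((i : ℕ) + 1)) else ∅).image (consBlock i) := by
  ext S
  simp only [Finset.mem_biUnion, Finset.mem_univ, true_and, Finset.mem_image]
  constructor
  · intro h
    obtain ⟨i, n', S', rfl, rfl⟩ := (mem_SPart.1 h).exists_consBlock hn
    refine ⟨i, S', ?_, rfl⟩
    rw [if_pos (by omega), Nat.add_sub_cancel, mem_SPart]
    exact SP_consBlock_iff.1 (mem_SPart.1 h)
  · rintro ⟨i, S', h, rfl⟩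
    split_ifs at h with hi
    · obtain ⟨n', rfl⟩ := Nat.exists_eq_add_of_le' hi
      rw [Nat.add_sub_cancel, mem_SPart] at h
      exact mem_SPart.2 (SP_consBlock_iff.2 h)
    · simp at h

theorem sum_SPart {M : Type*} [AddCommMonoid M] {r n : ℕ} (hn : 0 < n)
    (f : (Fin r → Finset ℕ) → M) :
    ∑ S ∈ SPart r n, f S = ∑ i : Fin r,
      if (i : ℕ) + 1 ≤ n then ∑ S ∈ SPart r (n - ((i : ℕ) + 1)), f (consBlock i S) else 0 := by
  rw [SPart_eq_biUnion hn, Finset.sum_biUnion]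
  · refine Finset.sum_congr rfl fun i _ => ?_
    rw [Finset.sum_image (consBlock_injective i).injOn]
    split_ifs <;> simp
  · intro i _ j _ hij
    rw [Function.onFun, Finset.disjoint_left]
    intro S hi hj
    obtain ⟨S', -, rfl⟩ := Finset.mem_image.1 hi
    obtain ⟨S'', -, h⟩ := Finset.mem_image.1 hj
    have h0 : 0 ∈ consBlock j S'' i := h ▸ zero_mem_consBlock.2 rfl
    exact hij (zero_mem_consBlock.1 h0)

theorem SPart_zero (r : ℕ) : SPart r 0 = {fun _ => ∅} := by
  ext S
  rw [mem_SPart, SP_iff, Finset.mem_singleton]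
  constructor
  · rintro ⟨-, h⟩
    ext k s
    exact iff_of_false (fun hs => absurd ((h s).1 ⟨k, s, hs, by omega, by omega⟩) (by omega))
      (by simp)
  · rintro rfl
    simp

theorem zero_notMem_image_add_succ (S : Finset ℕ) (i : ℕ) : 0 ∉ S.image (· + (i + 1)) := by
  simp

theorem sum_consBlock {M : Type*} [AddCommMonoid M] {r : ℕ} (i k : Fin r)
    (S : Fin r → Finset ℕ) (g : ℕ → M) :
    ∑ j ∈ consBlock i S k, g j =
      (if k = i then g 0 else 0) + ∑ j ∈ S k, g (j + ((i : ℕ) + 1)) := by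
  have h : ∑ j ∈ (S k).image (· + ((i : ℕ) + 1)), g j = ∑ j ∈ S k, g (j + ((i : ℕ) + 1)) :=
    Finset.sum_image fun a _ b _ hab => Nat.add_right_cancel hab
  unfold consBlock
  split_ifs
  · rw [Finset.sum_insert (zero_notMem_image_add_succ _ _), h]
  · rw [h, zero_add]

theorem sum_card_consBlock {r : ℕ} (i : Fin r) (S : Fin r → Finset ℕ) :
    ∑ k, ((consBlock i S k).card : ℤ) = ∑ k, ((S k).card : ℤ) + 1 := by
  have h (k : Fin r) : ((consBlock i S k).card : ℤ) = (if k = i then 1 else 0) + (S k).card := by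
    simpa using sum_consBlock i k S fun _ => (1 : ℤ)
  simp [h, Finset.sum_add_distrib, add_comm]

theorem insert_biUnion_consBlock {r n : ℕ} (i : Fin r) (S : Fin r → Finset ℕ) :
    insert (n + ((i : ℕ) + 1)) (Finset.univ.biUnion (consBlock i S)) =
      insert 0 ((insert n (Finset.univ.biUnion S)).image (· + ((i : ℕ) + 1))) := by
  ext x
  simp only [Finset.mem_insert, Finset.mem_biUnion, Finset.mem_univ, true_and, mem_consBlock,
    Finset.mem_image]
  constructor
  · rintro (rfl | ⟨k, ⟨rfl, rfl⟩ | ⟨s, hs, rfl⟩⟩)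
    · exact Or.inr ⟨n, Or.inl rfl, rfl⟩
    · exact Or.inl rfl
    · exact Or.inr ⟨s, Or.inr ⟨k, hs⟩, rfl⟩
  · rintro (rfl | ⟨s, rfl | ⟨k, hs⟩, rfl⟩)
    · exact Or.inr ⟨i, Or.inl ⟨rfl, rfl⟩⟩
    · exact Or.inl rfl
    · exact Or.inr ⟨k, Or.inr ⟨s, hs, rfl⟩⟩

theorem prod_pow_consBlock (q : ℕ) {L : Type*} [Field L] {r : ℕ} (A : Fin r → L) (i : Fin r)
    (S : Fin r → Finset ℕ) :
    ∏ k, A k ^ ∑ j ∈ consBlock i S k, q ^ j =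
      A i * (∏ k, A k ^ ∑ j ∈ S k, q ^ j) ^ q ^ ((i : ℕ) + 1) := by
  have h (k : Fin r) : A k ^ ∑ j ∈ consBlock i S k, q ^ j =
      (if k = i then A k else 1) * (A k ^ ∑ j ∈ S k, q ^ j) ^ q ^ ((i : ℕ) + 1) := by
    rw [sum_consBlock, pow_add, ← pow_mul, Finset.sum_mul]
    simp only [pow_add q]
    split_ifs <;> simp
  simp only [h, Finset.prod_mul_distrib, Finset.prod_pow]
  simp

/-- The contribution `A^S · h_{m - |S|}^{∪S ∪ {n}}` of a shadowed partition `S` of `n`. -/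
noncomputable def spTerm (q : ℕ) {L : Type*} [Field L] (T : L) {r : ℕ} (A : Fin r → L)
    (n : ℕ) (m : ℤ) (S : Fin r → Finset ℕ) : L :=
  (∏ i : Fin r, A i ^ ∑ j ∈ S i, q ^ j) *
    hpoly q T (insert n (Finset.univ.biUnion S)) (m - ∑ i : Fin r, ((S i).card : ℤ))

theorem spTerm_consBlock (q : ℕ) {L : Type*} [Field L] (T : L) {r : ℕ} (A : Fin r → L)
    (n : ℕ) (m : ℤ) (i : Fin r) (S : Fin r → Finset ℕ)
    (F : L →+* L) (hF : ∀ x, F x = x ^ q ^ ((i : ℕ) + 1)) :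
    spTerm q T A (n + ((i : ℕ) + 1)) (m + 1) (consBlock i S) =
      T * spTerm q T A (n + ((i : ℕ) + 1)) m (consBlock i S) +
        A i * F (spTerm q T A n m S) := by
  unfold spTerm
  rw [insert_biUnion_consBlock, sum_card_consBlock, prod_pow_consBlock, ← hF, map_mul,
    ← hpoly_image_add q T _ _ _ F hF,
    show m + 1 - (∑ k, ((S k).card : ℤ) + 1) = m - (∑ k, ((S k).card : ℤ) + 1) + 1 by ring,
    hpoly_insert_zero q T (zero_notMem_image_add_succ _ _),
    show m - (∑ k, ((S k).card : ℤ) + 1) + 1 = m - ∑ k, ((S k).card : ℤ) by ring]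
  ring

theorem spTerm_zero_empty (q : ℕ) {L : Type*} [Field L] (T : L) {r : ℕ} (A : Fin r → L)
    (m : ℕ) : spTerm q T A 0 m (fun _ => ∅) = T ^ m := by
  have h : insert 0 (Finset.univ.biUnion fun _ : Fin r => (∅ : Finset ℕ)) = {0} := by
    ext
    simp
  simp [spTerm, h, hpoly_natCast_eq_coeff]

/-- Let `q = p^s` be a prime power, `L` a field of characteristic `p` containing `𝔽_q`
(encoded: `L` has `q` distinct elements `a` with `a^q = a`), `T ∈ L`, `r ≥ 1` and
`A_1, …, A_r ∈ L`.  Define `c(n; m)` by `c(0;0) = 1`, `c(n;0) = 0` for `n ≠ 0`,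
`c(n;m) = 0` for `n < 0`, and
`c(n; m+1) = T c(n; m) + ∑_{i=1}^r A_i c(n-i; m)^{q^i}`; these are the coefficients of
`τ^n` in `φ_{T^m}` for `φ_T = T + A_1 τ + ⋯ + A_r τ^r`.  Then for all `m, n ≥ 0`,
`c(n; m) = ∑_{S ∈ P_r(n)} A^S · h_{m - |S|}^{(∪S ∪ {n})}`. -/
theorem drinfeld_multinomial (p q s : ℕ) (hp : p.Prime) (hs : 1 ≤ s) (hq : q = p ^ s)
    (L : Type*) [Field L] [CharP L p]
    (hFq : ∃ Φ : Finset L, Φ.card = q ∧ ∀ a ∈ Φ, a ^ q = a)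
    (T : L) (r : ℕ) (hr : 1 ≤ r) (A : Fin r → L)
    (c : ℤ → ℕ → L) (hc00 : c 0 0 = 1) (hc0 : ∀ n : ℤ, n ≠ 0 → c n 0 = 0)
    (hcneg : ∀ n : ℤ, n < 0 → ∀ m : ℕ, c n m = 0)
    (hcrec : ∀ n : ℤ, ∀ m : ℕ,
      c n (m + 1) =
        T * c n m + ∑ i : Fin r, A i * (c (n - ((i : ℕ) + 1)) m) ^ q ^ ((i : ℕ) + 1)) :
    ∀ m n : ℕ,
      c n m =
        ∑ S ∈ SPart r n,
          (∏ i : Fin r, A i ^ ∑ j ∈ S i, q ^ j) *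
            hpoly q T (insert n (Finset.univ.biUnion S))
              ((m : ℤ) - ∑ i : Fin r, ((S i).card : ℤ)) := by
  have : Fact p.Prime := ⟨hp⟩
  have hq0 : q ≠ 0 := hq ▸ pow_ne_zero _ hp.ne_zero
  have hF (i : ℕ) (x : L) : iterateFrobenius L p (s * i) x = x ^ q ^ i := by
    rw [iterateFrobenius_def, hq, pow_mul]
  change ∀ m n : ℕ, c n m = ∑ S ∈ SPart r n, spTerm q T A n m S
  intro m
  induction m with
  | zero =>
    intro n
    rcases Nat.eq_zero_or_pos n with rfl | hn
    · rw [SPart_zero, Finset.sum_singleton, spTerm_zero_empty, pow_zero]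
      exact hc00
    · rw [hc0 n (by omega), Finset.sum_eq_zero]
      intro S hS
      obtain ⟨i, n', S', rfl, rfl⟩ := (mem_SPart.1 hS).exists_consBlock hn
      rw [spTerm, sum_card_consBlock, hpoly_of_neg, mul_zero]
      have : 0 ≤ ∑ k, ((S' k).card : ℤ) := by positivity
      push_cast
      omega
  | succ m ih =>
    intro n
    rw [hcrec]
    rcases Nat.eq_zero_or_pos n with rfl | hn
    · rw [ih, SPart_zero, Finset.sum_singleton, Finset.sum_singleton, spTerm_zero_empty,
        spTerm_zero_empty, Finset.sum_eq_zero, add_zero, pow_succ']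
      intro i _
      rw [hcneg _ (by push_cast; omega), zero_pow (pow_ne_zero _ hq0), mul_zero]
    · rw [ih, sum_SPart hn, sum_SPart hn, Finset.mul_sum, ← Finset.sum_add_distrib]
      refine Finset.sum_congr rfl fun i _ => ?_
      split_ifs with hi
      · obtain ⟨n', rfl⟩ := Nat.exists_eq_add_of_le' hi
        have e : ((n' + ((i : ℕ) + 1) : ℕ) : ℤ) - ((i : ℕ) + 1) = (n' : ℤ) := by
          push_cast
          ring
        rw [e, ih, Nat.add_sub_cancel, ← hF, map_sum, Finset.mul_sum, Finset.mul_sum,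
          ← Finset.sum_add_distrib]
        refine Finset.sum_congr rfl fun S _ => ?_
        rw [Nat.cast_succ, spTerm_consBlock q T A n' m i S _ (hF _)]
      · rw [hcneg _ (by omega), zero_pow (pow_ne_zero _ hq0), mul_zero, mul_zero, add_zero]
end
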